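/- There exists a universal constant c ≥ 1 such that the following holds. Let (M, dist) be a metric space, let X be a real Banach space with X ≠ {0}, let D ≥ 1, and let P ⊆ M be a set of n points. Suppose that for every nonempty subset Q ⊆ P there exists a Lipschitz map f_Q : M → X with Lipschitz constant L_Q ∈ (0,∞) such that Σ_{x∈Q} Σ_{y∈Q} ‖f_Q(x) − f_Q(y)‖ ≥ (L_Q/D) · Σ_{x∈Q} Σ_{y∈Q} dist(x,y). Then there exists a Lipschitz map g : M → X with Lipschitz constant L ∈ (0,∞) such that sup_{t ≥ 0} t·Ψ_X(g(P), t) ≥ (L / (c·D·(1 + log D))) · sup_{t ≥ 0} t·Ψ_M(P, t); that is, there is an embedding of M into X with weak average distortion at most c·D·(1 + log D) with respect to P. -/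

import Mathlib

open Finset
open scoped Classical

universe u v

/-- `Ψ_M(P, t) = |{(x,y) ∈ P×P : dist(x,y) > t}| / n²` where `n = |P|`. -/
noncomputable def Psi {M : Type*} [MetricSpace M] (P : Finset M) (t : ℝ) : ℝ :=
  (((P ×ˢ P).filter fun z => t < dist z.1 z.2).card : ℝ) / (P.card : ℝ) ^ 2

/-- `Ψ_X(g(P), t) = |{(x,y) ∈ P×P : ‖g x - g y‖ > t}| / n²`. -/
noncomputable def PsiMap {M N : Type*} [MetricSpace M] [MetricSpace N]
    (g : M → N) (P : Finset M) (t : ℝ) : ℝ :=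
  (((P ×ˢ P).filter fun z => t < dist (g z.1) (g z.2)).card : ℝ) / (P.card : ℝ) ^ 2

lemma PsiMap_le_one {M N : Type*} [MetricSpace M] [MetricSpace N]
    (g : M → N) (P : Finset M) (t : ℝ) : PsiMap g P t ≤ 1 := by
  unfold PsiMap
  apply div_le_one_of_le₀ _ (by positivity)
  have h := Finset.card_filter_le (P ×ˢ P) (fun z => t < dist (g z.1) (g z.2))
  rw [Finset.card_product] at h
  have h2 : (((P ×ˢ P).filter fun z => t < dist (g z.1) (g z.2)).card : ℝ)
      ≤ ((P.card * P.card : ℕ) : ℝ) := by exact_mod_cast h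
  push_cast at h2
  nlinarith

lemma PsiMap_nonneg {M N : Type*} [MetricSpace M] [MetricSpace N]
    (g : M → N) (P : Finset M) (t : ℝ) : 0 ≤ PsiMap g P t := by
  unfold PsiMap
  positivity

lemma PsiMap_bdd {M N : Type*} [MetricSpace M] [MetricSpace N]
    (g : M → N) (P : Finset M) :
    BddAbove {v : ℝ | ∃ t : ℝ, 0 ≤ t ∧ v = t * PsiMap g P t} := by
  refine ⟨∑ z ∈ P ×ˢ P, dist (g z.1) (g z.2), ?_⟩
  rintro v ⟨t, ht, rfl⟩
  have h1 := PsiMap_le_one g P t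
  by_cases h : ∑ z ∈ P ×ˢ P, dist (g z.1) (g z.2) ≤ t
  · have : PsiMap g P t = 0 := by
      unfold PsiMap
      rw [Finset.filter_eq_empty_iff.2]
      · simp
      · intro z hz hlt
        have := Finset.single_le_sum (f := fun z : M × M => dist (g z.1) (g z.2))
          (fun i _ => dist_nonneg) hz
        linarith
    rw [this, mul_zero]
    exact Finset.sum_nonneg fun i _ => dist_nonneg
  · push Not at h
    nlinarith

lemma PsiMap_le_sup {M N : Type*} [MetricSpace M] [MetricSpace N]
    (g : M → N) (P : Finset M) (t : ℝ) (ht : 0 ≤ t) :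
    t * PsiMap g P t ≤ sSup {v : ℝ | ∃ t : ℝ, 0 ≤ t ∧ v = t * PsiMap g P t} :=
  le_csSup (PsiMap_bdd g P) ⟨t, ht, rfl⟩

lemma PsiMap_sup_nonneg {M N : Type*} [MetricSpace M] [MetricSpace N]
    (g : M → N) (P : Finset M) :
    0 ≤ sSup {v : ℝ | ∃ t : ℝ, 0 ≤ t ∧ v = t * PsiMap g P t} := by
  have := PsiMap_le_sup g P 0 le_rfl
  simpa using this

lemma PsiMap_card_le_sup {M N : Type*} [MetricSpace M] [MetricSpace N]
    (g : M → N) (P : Finset M) (hP : P.Nonempty) (t : ℝ) (ht : 0 ≤ t) :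
    t * (((P ×ˢ P).filter fun z => t < dist (g z.1) (g z.2)).card : ℝ) ≤
      sSup {v : ℝ | ∃ t : ℝ, 0 ≤ t ∧ v = t * PsiMap g P t} * (P.card : ℝ) ^ 2 := by
  have h := PsiMap_le_sup g P t ht
  have hn : (0 : ℝ) < P.card := by exact_mod_cast hP.card_pos
  have : t * (((P ×ˢ P).filter fun z => t < dist (g z.1) (g z.2)).card : ℝ)
      = (t * PsiMap g P t) * (P.card : ℝ) ^ 2 := by
    unfold PsiMap
    field_simp
  rw [this]
  gcongr

/-- Dyadic layer-cake bound. -/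
lemma dyadic_bound (a d : ℝ) (ha : 0 < a) (m : ℕ) (hd : d ≤ a * 2 ^ m) :
    d ≤ a + ∑ k ∈ Finset.range m, if a * 2 ^ k < d then a * 2 ^ k else 0 := by
  induction m with
  | zero => simpa using hd
  | succ m ih =>
    rw [Finset.sum_range_succ]
    by_cases h : d ≤ a * 2 ^ m
    · have := ih h
      rw [if_neg (not_lt.2 h)]
      linarith
    · push Not at h
      rw [if_pos h]
      have hs : ∑ k ∈ Finset.range m, (if a * 2 ^ k < d then a * 2 ^ k else 0)
          = ∑ k ∈ Finset.range m, a * 2 ^ k := by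
        apply Finset.sum_congr rfl
        intro k hk
        rw [if_pos]
        refine lt_of_le_of_lt ?_ h
        have := Finset.mem_range.1 hk
        gcongr
        norm_num
      have hg : ∑ k ∈ Finset.range m, a * (2:ℝ) ^ k = a * 2 ^ m - a := by
        rw [← Finset.mul_sum, geom_sum_eq (by norm_num)]
        ring
      rw [hs, hg]
      rw [pow_succ] at hd
      linarith

/-- Strong average versus weak average for a bounded map. -/
lemma sum_le_weak {M N : Type*} [MetricSpace M] [MetricSpace N]
    (g : M → N) (P Q : Finset M) (hQP : Q ⊆ P) (hP : P.Nonempty) (a : ℝ) (ha : 0 < a) (m : ℕ)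
    (hd : ∀ x ∈ Q, ∀ y ∈ Q, dist (g x) (g y) ≤ a * 2 ^ m) :
    ∑ x ∈ Q, ∑ y ∈ Q, dist (g x) (g y) ≤
      (a + m * sSup {v : ℝ | ∃ t : ℝ, 0 ≤ t ∧ v = t * PsiMap g P t}) * (P.card : ℝ) ^ 2 := by
  set w := sSup {v : ℝ | ∃ t : ℝ, 0 ≤ t ∧ v = t * PsiMap g P t} with hw
  rw [← Finset.sum_product']
  calc ∑ z ∈ Q ×ˢ Q, dist (g z.1) (g z.2)
      ≤ ∑ z ∈ Q ×ˢ Q, (a + ∑ k ∈ Finset.range m,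
          if a * 2 ^ k < dist (g z.1) (g z.2) then a * 2 ^ k else 0) := by
        apply Finset.sum_le_sum
        intro z hz
        rw [Finset.mem_product] at hz
        exact dyadic_bound a _ ha m (hd _ hz.1 _ hz.2)
    _ ≤ ∑ z ∈ P ×ˢ P, (a + ∑ k ∈ Finset.range m,
          if a * 2 ^ k < dist (g z.1) (g z.2) then a * 2 ^ k else 0) := by
        apply Finset.sum_le_sum_of_subset_of_nonneg (Finset.product_subset_product hQP hQP)
        intro z _ _
        apply add_nonneg ha.le
        apply Finset.sum_nonneg
        intro k _
        split_ifs <;> positivity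
    _ = a * (P.card : ℝ) ^ 2 + ∑ k ∈ Finset.range m, (a * 2 ^ k) *
          (((P ×ˢ P).filter fun z => a * 2 ^ k < dist (g z.1) (g z.2)).card : ℝ) := by
        rw [Finset.sum_add_distrib, Finset.sum_comm]
        congr 1
        · rw [Finset.sum_const, Finset.card_product, nsmul_eq_mul]
          push_cast
          ring
        · apply Finset.sum_congr rfl
          intro k _
          rw [← Finset.sum_filter, Finset.sum_const, nsmul_eq_mul, mul_comm]
    _ ≤ a * (P.card : ℝ) ^ 2 + ∑ k ∈ Finset.range m, w * (P.card : ℝ) ^ 2 := by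
        refine add_le_add le_rfl (Finset.sum_le_sum fun k _ => ?_)
        exact PsiMap_card_le_sup g P hP _ (by positivity)
    _ = _ := by
        rw [Finset.sum_const, Finset.card_range, nsmul_eq_mul]
        ring

lemma exists_m (D : ℝ) (hD : 1 ≤ D) :
    ∃ m : ℕ, 1024 * D ≤ 2 ^ m ∧ (m : ℝ) ≤ 11 * (1 + Real.log D) ∧ 0 < m := by
  have hl : 0 ≤ Real.log D := Real.log_nonneg hD
  refine ⟨10 + ⌈2 * Real.log D⌉₊, ?_, ?_, by omega⟩
  · rw [pow_add]
    have : D ≤ 2 ^ ⌈2 * Real.log D⌉₊ := by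
      rw [← Real.log_le_log_iff (by linarith) (by positivity), Real.log_pow]
      have h1 := Nat.le_ceil (2 * Real.log D)
      have h2 := Real.log_two_gt_d9
      nlinarith
    norm_num
    linarith
  · have := Nat.ceil_lt_add_one (a := 2 * Real.log D) (by positivity)
    push_cast
    linarith

/-- Case 1: a ball of radius `t/4` contains at least half of the points. -/
lemma case_one {M : Type*} {X : Type*} [MetricSpace M] [NormedAddCommGroup X]
    [NormedSpace ℝ X] [Nontrivial X] (P : Finset M) (hP : P.Nonempty) (t : ℝ) (ht : 0 < t)
    (x₀ : M) (hx : (P.card : ℝ) ≤ 2 * ((P.filter fun y => dist x₀ y ≤ t / 4).card : ℝ)) :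
    ∃ g : M → X, (∀ x y : M, ‖g x - g y‖ ≤ 1 * dist x y) ∧
      t * Psi P t ≤ 16 * sSup {v : ℝ | ∃ t : ℝ, 0 ≤ t ∧ v = t * PsiMap g P t} := by
  obtain ⟨e, he⟩ := exists_norm_eq X (zero_le_one (α := ℝ))
  have hdist : ∀ x y : M, ‖dist x₀ x • e - dist x₀ y • e‖ = |dist x₀ x - dist x₀ y| := by
    intro x y
    rw [← sub_smul, norm_smul, he, mul_one, Real.norm_eq_abs]
  refine ⟨fun x => dist x₀ x • e, ?_, ?_⟩
  · intro x y
    rw [hdist, one_mul, abs_le]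
    have h1 := dist_triangle x₀ x y
    have h2 := dist_triangle x₀ y x
    rw [dist_comm y x] at h2
    constructor <;> linarith
  · have hw := PsiMap_card_le_sup (fun x => dist x₀ x • e) P hP (t / 4) (by positivity)
    set w := sSup {v : ℝ | ∃ t : ℝ, 0 ≤ t ∧ v = t * PsiMap (fun x => dist x₀ x • e) P t}
    set B := P.filter fun y => dist x₀ y ≤ t / 4 with hB
    set O := P.filter fun y => t / 2 < dist x₀ y with hO
    have hn : (0 : ℝ) < P.card := by exact_mod_cast hP.card_pos
    have h1 : ((P ×ˢ P).filter fun z => t < dist z.1 z.2) ⊆ (O ×ˢ P) ∪ (P ×ˢ O) := by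
      intro z hz
      simp only [Finset.mem_filter, Finset.mem_product, Finset.mem_union, hO] at hz ⊢
      have := dist_triangle_left z.1 z.2 x₀
      by_cases h : t / 2 < dist x₀ z.1
      · exact Or.inl ⟨⟨hz.1.1, h⟩, hz.1.2⟩
      · exact Or.inr ⟨hz.1.1, hz.1.2, by linarith⟩
    have h2 := (Finset.card_le_card h1).trans (Finset.card_union_le _ _)
    rw [Finset.card_product, Finset.card_product] at h2
    have h3 : B ×ˢ O ⊆ ((P ×ˢ P).filter fun z =>
        t / 4 < dist (dist x₀ z.1 • e) (dist x₀ z.2 • e)) := by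
      intro z hz
      simp only [Finset.mem_filter, Finset.mem_product, hO, hB] at hz ⊢
      refine ⟨⟨hz.1.1, hz.2.1⟩, ?_⟩
      rw [dist_eq_norm, hdist, abs_sub_comm]
      refine lt_of_lt_of_le ?_ (le_abs_self _)
      linarith [hz.1.2, hz.2.2]
    have h4 := Finset.card_le_card h3
    rw [Finset.card_product] at h4
    have h2' : (((P ×ˢ P).filter fun z => t < dist z.1 z.2).card : ℝ)
      ≤ O.card * P.card + P.card * O.card := by exact_mod_cast h2
    have h4' : (B.card : ℝ) * O.card ≤ (((P ×ˢ P).filter fun z =>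
        t / 4 < dist (dist x₀ z.1 • e) (dist x₀ z.2 • e)).card : ℝ) := by exact_mod_cast h4
    unfold Psi
    rw [← mul_div_assoc, div_le_iff₀ (by positivity)]
    have hO0 : (0 : ℝ) ≤ O.card := by positivity
    have h5 : (P.card : ℝ) * O.card ≤ 2 * (B.card * O.card) := by nlinarith
    have h6 : (((P ×ˢ P).filter fun z => t < dist z.1 z.2).card : ℝ) ≤ 4 * (((P ×ˢ P).filter fun z =>
        t / 4 < dist (dist x₀ z.1 • e) (dist x₀ z.2 • e)).card : ℝ) := by linarith
    have h7 := mul_le_mul_of_nonneg_left h6 ht.le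
    linarith

/-- Case 2: extraction of a large subset of bounded diameter. -/
lemma case_two {M : Type*} [MetricSpace M] (P : Finset M) (hP : P.Nonempty) (t : ℝ) (ht : 0 < t)
    (hx : ∀ x ∈ P, 2 * ((P.filter fun y => dist x y ≤ t / 4).card : ℝ) < P.card)
    (hS : 4 * (((P ×ˢ P).filter fun z => 8 * t < dist z.1 z.2).card : ℝ) ≤ (P.card : ℝ) ^ 2) :
    ∃ Q ⊆ P, Q.Nonempty ∧ (∀ x ∈ Q, ∀ y ∈ Q, dist x y ≤ 16 * t) ∧
      3 / 64 * t * (P.card : ℝ) ^ 2 ≤ ∑ x ∈ Q, ∑ y ∈ Q, dist x y := by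
  have hn : (0 : ℝ) < P.card := by exact_mod_cast hP.card_pos
  have hsum : (((P ×ˢ P).filter fun z => 8 * t < dist z.1 z.2).card : ℝ)
      = ∑ x ∈ P, ((P.filter fun y => 8 * t < dist x y).card : ℝ) := by
    rw [Finset.card_filter, Finset.sum_product]
    push_cast
    apply Finset.sum_congr rfl
    intro x _
    rw [Finset.card_filter]
    push_cast
    rfl
  obtain ⟨x₀, hx₀, hfar⟩ : ∃ x₀ ∈ P, ((P.filter fun y => 8 * t < dist x₀ y).card : ℝ)
      ≤ (P.card : ℝ) / 4 := by
    apply Finset.exists_le_of_sum_le hP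
    rw [← hsum, Finset.sum_const, nsmul_eq_mul]
    nlinarith
  have hsplit : ∀ (R : Finset M) (p : M → Prop), ((R.filter p).card : ℝ)
      + ((R.filter fun y => ¬ p y).card : ℝ) = R.card := by
    intro R p
    exact_mod_cast Finset.card_filter_add_card_filter_not (s := R) p
  set Q := P.filter fun y => ¬ 8 * t < dist x₀ y with hQ
  have hQc : 3 / 4 * (P.card : ℝ) ≤ Q.card := by
    have := hsplit P (fun y => 8 * t < dist x₀ y)
    linarith
  have hQP : Q ⊆ P := Finset.filter_subset _ _
  refine ⟨Q, hQP, ?_, ?_, ?_⟩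
  · rw [← Finset.card_pos]
    have : (0 : ℝ) < Q.card := by linarith
    exact_mod_cast this
  · intro x hx y hy
    simp only [hQ, Finset.mem_filter, not_lt] at hx hy
    have := dist_triangle_left x y x₀
    linarith [hx.2, hy.2]
  · have hrow : ∀ x ∈ Q, (P.card : ℝ) / 4 * (t / 4) ≤ ∑ y ∈ Q, dist x y := by
      intro x hxQ
      have h1 := hx x (hQP hxQ)
      have h2 := hsplit Q (fun y => dist x y ≤ t / 4)
      have h3 : ((Q.filter fun y => dist x y ≤ t / 4).card : ℝ) ≤
          ((P.filter fun y => dist x y ≤ t / 4).card : ℝ) := by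
        exact_mod_cast Finset.card_le_card (Finset.filter_subset_filter _ hQP)
      calc (P.card : ℝ) / 4 * (t / 4)
          ≤ ((Q.filter fun y => ¬ dist x y ≤ t / 4).card : ℝ) * (t / 4) := by
            gcongr
            linarith
        _ = ∑ y ∈ Q.filter (fun y => ¬ dist x y ≤ t / 4), (t / 4) := by
            rw [Finset.sum_const, nsmul_eq_mul]
        _ ≤ ∑ y ∈ Q.filter (fun y => ¬ dist x y ≤ t / 4), dist x y := by
            apply Finset.sum_le_sum
            intro y hy
            have := (Finset.mem_filter.1 hy).2
            linarith
        _ ≤ ∑ y ∈ Q, dist x y :=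
            Finset.sum_le_sum_of_subset_of_nonneg (Finset.filter_subset _ _)
              (fun _ _ _ => dist_nonneg)
    calc 3 / 64 * t * (P.card : ℝ) ^ 2
        = (3 / 4 * (P.card : ℝ)) * ((P.card : ℝ) / 4 * (t / 4)) := by ring
      _ ≤ Q.card * ((P.card : ℝ) / 4 * (t / 4)) := by gcongr
      _ = ∑ x ∈ Q, ((P.card : ℝ) / 4 * (t / 4)) := by rw [Finset.sum_const, nsmul_eq_mul]
      _ ≤ _ := Finset.sum_le_sum hrow

/-- There is a universal constant `c ≥ 1` such that: if every nonempty subset `Q` of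
`P` admits a Lipschitz embedding into the nonzero Banach space `X` with average
distortion at most `D` with respect to `Q`, then there is a Lipschitz embedding of `M`
into `X` with weak average distortion at most `c·D·(1 + log D)` with respect to `P`. -/
theorem stmt9 :
    ∃ c : ℝ, 1 ≤ c ∧
      ∀ (M : Type u) [instM : MetricSpace M]
        (X : Type v) [instX : NormedAddCommGroup X] [instX' : NormedSpace ℝ X]
        [instX'' : CompleteSpace X] [instX''' : Nontrivial X]
        (D : ℝ), 1 ≤ D →
      ∀ (P : Finset M),
        (∀ Q ⊆ P, Q.Nonempty →
          ∃ (f : M → X) (L : ℝ), 0 < L ∧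
            (∀ x y : M, ‖f x - f y‖ ≤ L * dist x y) ∧
            ∑ x ∈ Q, ∑ y ∈ Q, ‖f x - f y‖ ≥ (L / D) * ∑ x ∈ Q, ∑ y ∈ Q, dist x y) →
        ∃ (g : M → X) (L : ℝ), 0 < L ∧
          (∀ x y : M, ‖g x - g y‖ ≤ L * dist x y) ∧
          sSup {v : ℝ | ∃ t : ℝ, 0 ≤ t ∧ v = t * PsiMap g P t} ≥
            (L / (c * D * (1 + Real.log D))) *
              sSup {v : ℝ | ∃ t : ℝ, 0 ≤ t ∧ v = t * Psi P t} := by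
  refine ⟨704, by norm_num, ?_⟩
  intro M _ X _ _ _ _ D hD P hyp
  have hl : 0 ≤ Real.log D := Real.log_nonneg hD
  have hSid : sSup {v : ℝ | ∃ t : ℝ, 0 ≤ t ∧ v = t * Psi P t}
    = sSup {v : ℝ | ∃ t : ℝ, 0 ≤ t ∧ v = t * PsiMap (id : M → M) P t} := rfl
  have hS0 : 0 ≤ sSup {v : ℝ | ∃ t : ℝ, 0 ≤ t ∧ v = t * Psi P t} := by
    rw [hSid]
    exact PsiMap_sup_nonneg _ _
  have hle : ∀ t : ℝ, 0 ≤ t → t * Psi P t ≤ sSup {v : ℝ | ∃ t : ℝ, 0 ≤ t ∧ v = t * Psi P t} :=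
    fun t ht => PsiMap_le_sup (id : M → M) P t ht
  have hex : ∀ b < sSup {v : ℝ | ∃ t : ℝ, 0 ≤ t ∧ v = t * Psi P t},
      ∃ t : ℝ, 0 ≤ t ∧ b < t * Psi P t := by
    intro b hb
    obtain ⟨v, ⟨t, ht, rfl⟩, hv⟩ := exists_lt_of_lt_csSup
      (s := {v : ℝ | ∃ t : ℝ, 0 ≤ t ∧ v = t * Psi P t}) ⟨0, 0, le_rfl, by simp⟩ hb
    exact ⟨t, ht, hv⟩
  generalize sSup {v : ℝ | ∃ t : ℝ, 0 ≤ t ∧ v = t * Psi P t} = S at *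
  rcases hS0.eq_or_lt with h0 | hSpos
  · refine ⟨fun _ => 0, 1, one_pos, ?_, ?_⟩
    · intro x y
      simp
    · rw [← h0, mul_zero]
      exact PsiMap_sup_nonneg _ _
  obtain ⟨t, ht0, ht⟩ := hex (S / 2) (by linarith)
  have htpos : 0 < t := by
    rcases ht0.eq_or_lt with h | h
    · rw [← h] at ht
      linarith
    · exact h
  have hP : P.Nonempty := by
    rcases P.eq_empty_or_nonempty with h | h
    · subst h
      simp [Psi] at ht
      linarith
    · exact h
  have hn : (0 : ℝ) < P.card := by exact_mod_cast hP.card_pos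
  have hS2 : S ≤ 2 * t := by
    have : Psi P t ≤ 1 := PsiMap_le_one (id : M → M) P t
    nlinarith
  by_cases hcase : ∃ x₀ : M, (P.card : ℝ) ≤ 2 * ((P.filter fun y => dist x₀ y ≤ t / 4).card : ℝ)
  · obtain ⟨x₀, hx₀⟩ := hcase
    obtain ⟨g, hg, hgw⟩ := case_one (X := X) P hP t htpos x₀ hx₀
    refine ⟨g, 1, one_pos, hg, ?_⟩
    rw [ge_iff_le, div_mul_eq_mul_div, div_le_iff₀ (by positivity), one_mul]
    have hw := PsiMap_sup_nonneg g P
    set w := sSup {v : ℝ | ∃ t : ℝ, 0 ≤ t ∧ v = t * PsiMap g P t}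
    have : w * (704 * 1 * (1 + 0)) ≤ w * (704 * D * (1 + Real.log D)) := by gcongr
    linarith
  · push Not at hcase
    obtain ⟨Q, hQP, hQ, hdiam, hQsum⟩ := case_two P hP t htpos (fun x _ => hcase x) (by
      have h8 := hle (8 * t) (by positivity)
      have h9 : Psi P (8 * t) ≤ 1 / 4 := by nlinarith
      unfold Psi at h9
      rw [div_le_iff₀ (by positivity)] at h9
      linarith)
    obtain ⟨f, L, hL, hf, hfs⟩ := hyp Q hQP hQ
    refine ⟨f, L, hL, hf, ?_⟩
    obtain ⟨m, hm1, hm2, hm0⟩ := exists_m D hD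
    have key := sum_le_weak f P Q hQP hP (L * t / (64 * D)) (by positivity) m (by
      intro x hx y hy
      rw [dist_eq_norm]
      calc ‖f x - f y‖ ≤ L * dist x y := hf x y
        _ ≤ L * (16 * t) := by
            gcongr
            exact hdiam x hx y hy
        _ = L * t / (64 * D) * (1024 * D) := by
            field_simp
            norm_num
        _ ≤ _ := by gcongr)
    simp only [dist_eq_norm] at key
    have hw := PsiMap_sup_nonneg f P
    generalize sSup {v : ℝ | ∃ t : ℝ, 0 ≤ t ∧ v = t * PsiMap f P t} = w at *
    have h1 : L / D * (3 / 64 * t * (P.card : ℝ) ^ 2) ≤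
        (L * t / (64 * D) + m * w) * (P.card : ℝ) ^ 2 := by
      refine le_trans ?_ (hfs.le.trans key)
      gcongr
    have h2 : L / D * (3 / 64 * t) ≤ L * t / (64 * D) + m * w := by
      rw [← mul_assoc] at h1
      exact le_of_mul_le_mul_right h1 (by positivity)
    have h3 : L * t ≤ 32 * D * (m * w) := by
      have e1 : L / D * (3 / 64 * t) = 3 * (L * t / (64 * D)) := by ring
      rw [e1] at h2
      have h4 : L * t / (64 * D) ≤ m * w / 2 := by linarith
      rw [div_le_iff₀ (by positivity)] at h4
      linarith
    rw [ge_iff_le, div_mul_eq_mul_div, div_le_iff₀ (by positivity)]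
    calc L * S ≤ L * (2 * t) := by gcongr
      _ = 2 * (L * t) := by ring
      _ ≤ 2 * (32 * D * (m * w)) := by gcongr
      _ ≤ 2 * (32 * D * (11 * (1 + Real.log D) * w)) := by gcongr
      _ = _ := by ring
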